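/- Let c, d be real numbers with 0 < d < c. Then (1/(2πi·y₁)) ∮_{|ξ|=1} log(c + dξ) · [ (ξ²−1)/(ξ(ξ + 1/h)(ξ + y₂/h)) − (h²/y₂)·(ξ²−1)/(ξ(ξ + h)(ξ + h/y₂)) ] dξ = ((y₂−1)/y₂)·log c + ((y₁−1)/y₁)·log(c − dh) + ((y₁+y₂)/(y₁y₂))·log((ch − dy₂)/h), where the contour integral is taken counterclockwise over the unit circle. -/

import Mathlib

open Real

lemma aux_slit (c d : ℝ) (hd0 : 0 < d) (hdc : d < c) (z : ℂ) (hz : ‖z‖ ≤ 1) :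
    (c : ℂ) + (d : ℂ) * z ∈ Complex.slitPlane := by
  left
  have h1 := (abs_le.1 (Complex.abs_re_le_norm z)).1
  simp
  nlinarith

lemma aux_diff (c d : ℝ) (hd0 : 0 < d) (hdc : d < c) (z : ℂ) (hz : ‖z‖ ≤ 1) :
    DifferentiableAt ℂ (fun ξ : ℂ => Complex.log ((c : ℂ) + (d : ℂ) * ξ)) z := by
  apply DifferentiableAt.clog
  · fun_prop
  · exact aux_slit c d hd0 hdc z hz

lemma aux_ne (a : ℝ) (ha : |a| ≠ 1) (z : ℂ) (hz : ‖z‖ = 1) : z + (a : ℂ) ≠ 0 := by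
  intro h0
  have : z = -(a : ℂ) := eq_neg_of_add_eq_zero_left h0
  rw [this] at hz
  simp at hz
  exact ha hz

lemma aux_in (c d : ℝ) (hd0 : 0 < d) (hdc : d < c) (a : ℝ) (ha0 : 0 ≤ a) (ha : a < 1) :
    (∮ ξ in C(0, 1), Complex.log ((c : ℂ) + (d : ℂ) * ξ) * (ξ + (a : ℂ))⁻¹) =
      2 * π * Complex.I * (Real.log (c - d * a) : ℝ) := by
  have hD : DifferentiableOn ℂ (fun ξ : ℂ => Complex.log ((c : ℂ) + (d : ℂ) * ξ))
      (Metric.closedBall 0 1) := fun z hz =>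
    (aux_diff c d hd0 hdc z (by simpa using hz)).differentiableWithinAt
  have hw : (-(a : ℂ)) ∈ Metric.ball (0 : ℂ) 1 := by
    simp [abs_of_nonneg ha0, ha]
  have := hD.circleIntegral_sub_inv_smul hw
  have e : (Real.log (c - d * a) : ℂ) = Complex.log ((c : ℂ) + (d : ℂ) * (-(a : ℂ))) := by
    rw [Complex.ofReal_log (by nlinarith)]
    push_cast
    ring_nf
  rw [e]
  simp only [smul_eq_mul, sub_neg_eq_add] at this
  rw [← this]
  congr 1
  funext ξ
  ring

lemma aux_out (c d : ℝ) (hd0 : 0 < d) (hdc : d < c) (a : ℝ) (ha : 1 < a) :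
    (∮ ξ in C(0, 1), Complex.log ((c : ℂ) + (d : ℂ) * ξ) * (ξ + (a : ℂ))⁻¹) = 0 := by
  have hd : ∀ z : ℂ, ‖z‖ ≤ 1 → DifferentiableAt ℂ
      (fun ξ : ℂ => Complex.log ((c : ℂ) + (d : ℂ) * ξ) * (ξ + (a : ℂ))⁻¹) z := by
    intro z hz
    apply (aux_diff c d hd0 hdc z hz).mul
    apply DifferentiableAt.inv (by fun_prop)
    intro h0
    have : z = -(a : ℂ) := eq_neg_of_add_eq_zero_left h0
    rw [this] at hz
    simp at hz
    have := le_abs_self a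
    linarith
  apply Complex.circleIntegral_eq_zero_of_differentiable_on_off_countable (s := ∅) zero_le_one
    Set.countable_empty
  · intro z hz
    exact (hd z (by simpa using hz)).continuousAt.continuousWithinAt
  · intro z hz
    exact hd z (by simpa using (Metric.ball_subset_closedBall hz.1))

lemma aux_int (c d : ℝ) (hd0 : 0 < d) (hdc : d < c) (a : ℝ) (ha : |a| ≠ 1) (K : ℂ) :
    CircleIntegrable (fun ξ : ℂ => K * (Complex.log ((c : ℂ) + (d : ℂ) * ξ) * (ξ + (a : ℂ))⁻¹))
      0 1 := by
  apply ContinuousOn.circleIntegrable zero_le_one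
  intro z hz
  have hz1 : ‖z‖ = 1 := by simpa using hz
  apply ContinuousAt.continuousWithinAt
  apply ContinuousAt.mul continuousAt_const
  apply (aux_diff c d hd0 hdc z hz1.le).continuousAt.mul
  exact ContinuousAt.inv₀ (by fun_prop) (aux_ne a ha z hz1)

lemma aux_pf (A B C a b K : ℝ) (z : ℂ) (h0 : z ≠ 0) (ha : z + (a : ℂ) ≠ 0)
    (hb : z + (b : ℂ) ≠ 0)
    (h1 : A + B + C = K) (h2 : A * (a + b) + B * b + C * a = 0) (h3 : A * (a * b) = -K) :
    (K : ℂ) * (z ^ 2 - 1) / (z * (z + a) * (z + b)) =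
      A * z⁻¹ + B * (z + (a : ℂ))⁻¹ + C * (z + (b : ℂ))⁻¹ := by
  have g1 : (A : ℂ) + B + C = K := by rw [← h1]; push_cast; ring
  have g2 : (A : ℂ) * (a + b) + B * b + C * a = 0 := by exact_mod_cast h2
  have g3 : (A : ℂ) * (a * b) = -K := by exact_mod_cast h3
  field_simp
  linear_combination (-z ^ 2) * g1 - z * g2 - g3

theorem stmt5 (y₁ y₂ : ℝ) (hy₁ : y₁ ∈ Set.Ioo (0 : ℝ) 1) (hy₂ : y₂ ∈ Set.Ioo (0 : ℝ) 1)
    (h : ℝ) (hh : h = Real.sqrt (y₁ + y₂ - y₁ * y₂))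
    (c d : ℝ) (hd0 : 0 < d) (hdc : d < c) :
    (1 / (2 * (π : ℂ) * Complex.I * (y₁ : ℂ))) *
        (∮ ξ in C(0, 1),
          Complex.log ((c : ℂ) + (d : ℂ) * ξ) *
            ((ξ ^ 2 - 1) / (ξ * (ξ + 1 / (h : ℂ)) * (ξ + (y₂ / h : ℝ))) -
              ((h ^ 2 / y₂ : ℝ) : ℂ) * (ξ ^ 2 - 1) / (ξ * (ξ + (h : ℂ)) * (ξ + (h / y₂ : ℝ))))) =
      ((((y₂ - 1) / y₂) * Real.log c + ((y₁ - 1) / y₁) * Real.log (c - d * h) +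
        ((y₁ + y₂) / (y₁ * y₂)) * Real.log ((c * h - d * y₂) / h) : ℝ) : ℂ) := by
  obtain ⟨p1, q1⟩ := hy₁
  obtain ⟨p2, q2⟩ := hy₂
  have hpos : 0 < y₁ + y₂ - y₁ * y₂ := by nlinarith
  have hsq : h ^ 2 = y₁ + y₂ - y₁ * y₂ := by rw [hh, Real.sq_sqrt hpos.le]
  have h0 : 0 < h := by rw [hh]; exact Real.sqrt_pos.2 hpos
  have hl1 : h < 1 := by nlinarith [mul_pos (sub_pos.2 q1) (sub_pos.2 q2)]
  have hy2h : y₂ < h := by nlinarith [mul_pos p1 (sub_pos.2 q2), mul_pos p2 (sub_pos.2 q2)]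
  clear hh
  have i1 : 1 < 1 / h := by rw [lt_div_iff₀ h0]; linarith
  have i2 : 1 < h / y₂ := by rw [lt_div_iff₀ p2]; linarith
  have i3 : y₂ / h < 1 := by rw [div_lt_iff₀ h0]; linarith
  have i4 : 0 < y₂ / h := by positivity
  have n0 : |(0:ℝ)| ≠ 1 := by simp
  have n1 : |1 / h| ≠ 1 := by rw [abs_of_pos (by linarith)]; exact i1.ne'
  have n2 : |h / y₂| ≠ 1 := by rw [abs_of_pos (by linarith)]; exact i2.ne'
  have n3 : |y₂ / h| ≠ 1 := by rw [abs_of_pos (by linarith)]; exact i3.ne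
  have n4 : |h| ≠ 1 := by rw [abs_of_pos (by linarith)]; exact hl1.ne
  have key : Set.EqOn (fun ξ : ℂ => Complex.log ((c : ℂ) + (d : ℂ) * ξ) *
            ((ξ ^ 2 - 1) / (ξ * (ξ + 1 / (h : ℂ)) * (ξ + (y₂ / h : ℝ))) -
              ((h ^ 2 / y₂ : ℝ) : ℂ) * (ξ ^ 2 - 1) / (ξ * (ξ + (h : ℂ)) * (ξ + (h / y₂ : ℝ)))))
      (fun ξ : ℂ =>
        ((y₁ * (y₂ - 1) / y₂ : ℝ) : ℂ) *
            (Complex.log ((c : ℂ) + (d : ℂ) * ξ) * (ξ + ((0 : ℝ) : ℂ))⁻¹) +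
        ((1 - y₁ : ℝ) : ℂ) *
            (Complex.log ((c : ℂ) + (d : ℂ) * ξ) * (ξ + ((1 / h : ℝ) : ℂ))⁻¹) +
        (((y₁ + y₂) / y₂ : ℝ) : ℂ) *
            (Complex.log ((c : ℂ) + (d : ℂ) * ξ) * (ξ + ((y₂ / h : ℝ) : ℂ))⁻¹) +
        ((y₁ - 1 : ℝ) : ℂ) *
            (Complex.log ((c : ℂ) + (d : ℂ) * ξ) * (ξ + (h : ℂ))⁻¹) +
        ((-((y₁ + y₂) / y₂) : ℝ) : ℂ) *
            (Complex.log ((c : ℂ) + (d : ℂ) * ξ) * (ξ + ((h / y₂ : ℝ) : ℂ))⁻¹))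
      (Metric.sphere 0 1) := by
    intro z hz
    have hz1 : ‖z‖ = 1 := by simpa using hz
    have z0 : z ≠ 0 := by rintro rfl; simp at hz1
    have e1 := aux_pf (-(h ^ 2 / y₂)) (1 - y₁) ((y₁ + y₂) / y₂)
      (1 / h) (y₂ / h) 1 z z0 (aux_ne _ n1 z hz1) (aux_ne _ n3 z hz1)
      (by rw [hsq]; field_simp; ring)
      (by rw [hsq]; field_simp; ring)
      (by field_simp)
    have e2 := aux_pf (-1) (1 - y₁) ((y₁ + y₂) / y₂)
      h (h / y₂) (h ^ 2 / y₂) z z0 (aux_ne _ n4 z hz1) (aux_ne _ n2 z hz1)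
      (by rw [hsq]; field_simp; ring)
      (by field_simp; ring)
      (by field_simp)
    have e3 : y₁ * (y₂ - 1) / y₂ = -(h ^ 2 / y₂) - (-1) := by
      rw [hsq]; field_simp; ring
    simp only
    rw [e2, e3]
    rw [Complex.ofReal_one, one_mul] at e1
    have e4 : (1 / (h : ℂ)) = ((1 / h : ℝ) : ℂ) := by push_cast; rfl
    rw [e4, e1]
    push_cast
    ring
  rw [circleIntegral.integral_congr zero_le_one key]
  have I := aux_int c d hd0 hdc
  have J0 := I _ n0 ((y₁ * (y₂ - 1) / y₂ : ℝ) : ℂ)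
  have J1 := I _ n1 ((1 - y₁ : ℝ) : ℂ)
  have J3 := I _ n3 (((y₁ + y₂) / y₂ : ℝ) : ℂ)
  have J4 := I _ n4 ((y₁ - 1 : ℝ) : ℂ)
  have J2 := I _ n2 ((-((y₁ + y₂) / y₂) : ℝ) : ℂ)
  rw [circleIntegral.integral_add, circleIntegral.integral_add, circleIntegral.integral_add,
    circleIntegral.integral_add]
  rotate_left
  · exact J0
  · exact J1
  · exact J0.add J1
  · exact J3
  · exact (J0.add J1).add J3
  · exact J4
  · exact ((J0.add J1).add J3).add J4
  · exact J2
  simp only [circleIntegral.integral_const_mul]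
  rw [aux_in c d hd0 hdc 0 le_rfl one_pos, aux_out c d hd0 hdc _ i1,
    aux_in c d hd0 hdc _ i4.le i3, aux_in c d hd0 hdc _ h0.le hl1, aux_out c d hd0 hdc _ i2]
  have e5 : (c * h - d * y₂) / h = c - d * (y₂ / h) := by field_simp
  rw [e5, mul_zero d, sub_zero]
  have c1 : (y₁ : ℂ) ≠ 0 := by exact_mod_cast p1.ne'
  have c2 : (y₂ : ℂ) ≠ 0 := by exact_mod_cast p2.ne'
  have c3 : (π : ℂ) ≠ 0 := by exact_mod_cast Real.pi_ne_zero
  have c4 := Complex.I_ne_zero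
  generalize Real.log (c - d * (y₂ / h)) = X
  generalize Real.log (c - d * h) = Y
  generalize Real.log c = Z
  push_cast
  field_simp
  ring
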